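/- Let a ≥ 0 and k ≥ 2 be integers and set b = ak+k−1. Let T be any tree with exactly k interior (non-leaf) vertices and b leaves. Then λ₁(T) ≤ σ₂(a,k) = (k + 2a + 1 − √((k−1)² + 4))/2, and equality holds if and only if T is isomorphic to the star-like path tree SLP(a, a+1; 0; k−1, 0). -/

import Mathlib

open scoped Classical
open Finset

/-- The Dirichlet energy `∑_{{x,y} ∈ E} (f(x) - f(y))²` of a function on the vertices,
computed as half of the sum over ordered adjacent pairs. -/
noncomputable def dirichletForm {V : Type*} [Fintype V] (G : SimpleGraph V) (f : V → ℝ) : ℝ :=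
  (∑ x : V, ∑ y : V, if G.Adj x y then (f x - f y) ^ 2 else 0) / 2

/-- The first Dirichlet eigenvalue of a graph `G` with boundary `B`:
the infimum of Rayleigh quotients of nonzero functions vanishing on `B`. -/
noncomputable def lambda1 {V : Type*} [Fintype V] (G : SimpleGraph V) (B : Finset V) : ℝ :=
  sInf { r : ℝ | ∃ f : V → ℝ, (∀ x ∈ B, f x = 0) ∧ f ≠ 0 ∧
    r = dirichletForm G f / ∑ x ∈ Bᶜ, f x ^ 2 }

/-- The distance from a vertex to a set of vertices. -/
noncomputable def distToSet {V : Type*} (G : SimpleGraph V) (B : Finset V) (v : V) : ℕ :=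
  sInf { n : ℕ | ∃ b ∈ B, G.dist v b = n }

/-- The inscribed radius of a graph with boundary: `max_{v ∈ V} dist(v, B)`. -/
noncomputable def inradius {V : Type*} [Fintype V] (G : SimpleGraph V) (B : Finset V) : ℕ :=
  Finset.univ.sup fun v => distToSet G B v

/-- The diameter of a graph: `max_{v,w ∈ V} dist(v, w)`. -/
noncomputable def graphDiam {V : Type*} [Fintype V] (G : SimpleGraph V) : ℕ :=
  Finset.univ.sup fun v => Finset.univ.sup fun w => G.dist v w

/-- The set of leaves (degree-one vertices) of a graph. -/
noncomputable def leaves {V : Type*} [Fintype V] (G : SimpleGraph V) : Finset V :=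
  Finset.univ.filter fun v => G.degree v = 1

/-- Vertex type of the star-like path tree `SLP(p, q; c; d, e)`:
`path i` are the path vertices `u₀, …, u_c`; `dbr i` are the vertices `u_{0,i}` attached
to `u₀`; `ebr j` are the vertices `u_{c,j}` attached to `u_c`; `pleaf0` are the `p`
pendant leaves at `u₀`; `pleafc` are the `p` pendant leaves at `u_c` (absent when
`c = 0`, since then `u_c = u₀`); `qleafD i m`, `qleafE j m`, `qleafM m m'` are the `q`
pendant leaves at `u_{0,i}`, at `u_{c,j}`, and at the interior path vertex `u_{m+1}`
(`1 ≤ m+1 ≤ c-1`), respectively. -/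
inductive SLPVert (p q c d e : ℕ) : Type where
  | path : Fin (c + 1) → SLPVert p q c d e
  | dbr : Fin d → SLPVert p q c d e
  | ebr : Fin e → SLPVert p q c d e
  | pleaf0 : Fin p → SLPVert p q c d e
  | pleafc : Fin (if c = 0 then 0 else p) → SLPVert p q c d e
  | qleafD : Fin d → Fin q → SLPVert p q c d e
  | qleafE : Fin e → Fin q → SLPVert p q c d e
  | qleafM : Fin (c - 1) → Fin q → SLPVert p q c d e
deriving DecidableEq, Fintype

/-- Base relation generating the edges of the star-like path tree. -/
def SLPRel {p q c d e : ℕ} : SLPVert p q c d e → SLPVert p q c d e → Prop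
  | .path i, .path j => (i : ℕ) + 1 = (j : ℕ)
  | .path i, .dbr _ => (i : ℕ) = 0
  | .path i, .ebr _ => (i : ℕ) = c
  | .path i, .pleaf0 _ => (i : ℕ) = 0
  | .path i, .pleafc _ => (i : ℕ) = c
  | .path i, .qleafM m _ => (i : ℕ) = (m : ℕ) + 1
  | .dbr i, .qleafD i' _ => i = i'
  | .ebr j, .qleafE j' _ => j = j'
  | _, _ => False

/-- The star-like path tree `SLP(p, q; c; d, e)`. -/
def SLP (p q c d e : ℕ) : SimpleGraph (SLPVert p q c d e) :=
  SimpleGraph.fromRel SLPRel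

/-- `σ₂(a,k) = (k + 2a + 1 − √((k−1)² + 4)) / 2`. -/
noncomputable def sigma2 (a k : ℕ) : ℝ :=
  ((k : ℝ) + 2 * a + 1 - Real.sqrt (((k : ℝ) - 1) ^ 2 + 4)) / 2

open Matrix in
theorem dirichletForm_eq_dotProduct {V : Type*} [Fintype V] (G : SimpleGraph V) (f : V → ℝ) :
    dirichletForm G f = f ⬝ᵥ (G.lapMatrix ℝ *ᵥ f) := by
  rw [← Matrix.toLinearMap₂'_apply', G.lapMatrix_toLinearMap₂' ℝ, dirichletForm]

theorem dirichletForm_nonneg {V : Type*} [Fintype V] (G : SimpleGraph V) (f : V → ℝ) :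
    0 ≤ dirichletForm G f := by
  unfold dirichletForm
  positivity

open Matrix in
theorem dirichletForm_add_single {V : Type*} [Fintype V] (G : SimpleGraph V) (f : V → ℝ)
    (w : V) (t : ℝ) :
    dirichletForm G (f + Pi.single w t) =
      dirichletForm G f + 2 * t * (G.lapMatrix ℝ *ᵥ f) w + t ^ 2 * G.degree w := by
  have hsymm : f ⬝ᵥ (G.lapMatrix ℝ *ᵥ Pi.single w t) = t * (G.lapMatrix ℝ *ᵥ f) w := by
    rw [dotProduct_mulVec, ← mulVec_transpose, (G.isSymm_lapMatrix ℝ).eq, dotProduct_single, mul_comm]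
  have hself : (G.lapMatrix ℝ *ᵥ Pi.single w t) w = t * G.degree w := by
    rw [G.lapMatrix_mulVec_apply, Finset.sum_eq_zero]
    · simp [mul_comm]
    · intro u hu
      rw [SimpleGraph.mem_neighborFinset] at hu
      exact Pi.single_eq_of_ne hu.ne' _
  simp only [dirichletForm_eq_dotProduct, mulVec_add, add_dotProduct, dotProduct_add, hsymm,
    single_dotProduct, hself]
  ring

theorem sum_compl_sq_add_single {V : Type*} [Fintype V] (B : Finset V) (f : V → ℝ) {w : V}
    (hw : w ∉ B) (t : ℝ) :
    ∑ y ∈ Bᶜ, (f + Pi.single w t : V → ℝ) y ^ 2 =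
      ∑ y ∈ Bᶜ, f y ^ 2 + 2 * t * f w + t ^ 2 := by
  have h : ∀ y, (f + Pi.single w t : V → ℝ) y ^ 2 =
      f y ^ 2 + if y = w then 2 * t * f w + t ^ 2 else 0 := by
    intro y
    by_cases hy : y = w
    · subst hy
      simp
      ring
    · simp [hy]
  simp only [h, Finset.sum_add_distrib, Finset.sum_ite_eq', Finset.mem_compl, hw,
    not_false_eq_true, if_true]
  ring

theorem lambda1_le {V : Type*} [Fintype V] (G : SimpleGraph V) (B : Finset V) {f : V → ℝ}
    (hB : ∀ x ∈ B, f x = 0) (hf : f ≠ 0) :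
    lambda1 G B ≤ dirichletForm G f / ∑ x ∈ Bᶜ, f x ^ 2 := by
  refine csInf_le ⟨0, ?_⟩ ⟨f, hB, hf, rfl⟩
  rintro r ⟨g, -, -, rfl⟩
  have := dirichletForm_nonneg G g
  positivity

theorem sum_compl_sq_pos {V : Type*} [Fintype V] (B : Finset V) {f : V → ℝ}
    (hB : ∀ x ∈ B, f x = 0) (hf : f ≠ 0) : 0 < ∑ x ∈ Bᶜ, f x ^ 2 := by
  obtain ⟨x, hx⟩ := Function.ne_iff.mp hf
  have hx' : f x ≠ 0 := hx
  refine Finset.sum_pos' (fun _ _ => sq_nonneg _) ⟨x, ?_, by positivity⟩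
  exact Finset.mem_compl.mpr fun h => hx' (hB x h)

theorem lambda1_mul_le {V : Type*} [Fintype V] (G : SimpleGraph V) (B : Finset V) {f : V → ℝ}
    (hB : ∀ x ∈ B, f x = 0) : lambda1 G B * ∑ x ∈ Bᶜ, f x ^ 2 ≤ dirichletForm G f := by
  by_cases hf : f = 0
  · simpa [hf] using dirichletForm_nonneg G 0
  · exact (le_div_iff₀ (sum_compl_sq_pos B hB hf)).mp (lambda1_le G B hB hf)

theorem le_lambda1 {V : Type*} [Fintype V] (G : SimpleGraph V) {B : Finset V} {c : ℝ}
    (hne : Bᶜ.Nonempty)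
    (h : ∀ f : V → ℝ, (∀ x ∈ B, f x = 0) → c * ∑ x ∈ Bᶜ, f x ^ 2 ≤ dirichletForm G f) :
    c ≤ lambda1 G B := by
  obtain ⟨v, hv⟩ := hne
  refine le_csInf ⟨_, Pi.single v 1, ?_, by simp, rfl⟩ ?_
  · intro x hx
    refine Pi.single_eq_of_ne ?_ _
    rintro rfl
    exact Finset.mem_compl.mp hv hx
  · rintro r ⟨f, hB, hf, rfl⟩
    exact (le_div_iff₀ (sum_compl_sq_pos B hB hf)).mpr (h f hB)

open Matrix in
/-- A function attaining the first Dirichlet eigenvalue is an eigenfunction. -/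
theorem lapMatrix_mulVec_eq_of_minimizer {V : Type*} [Fintype V] (G : SimpleGraph V)
    (B : Finset V) {f : V → ℝ} (hB : ∀ x ∈ B, f x = 0)
    (hf : dirichletForm G f = lambda1 G B * ∑ x ∈ Bᶜ, f x ^ 2) {w : V} (hw : w ∉ B) :
    (G.lapMatrix ℝ *ᵥ f) w = lambda1 G B * f w := by
  set β := (G.lapMatrix ℝ *ᵥ f) w - lambda1 G B * f w with hβ
  have key : ∀ t : ℝ, 0 ≤ (G.degree w - lambda1 G B) * (t * t) + 2 * β * t + 0 := by
    intro t
    have h := lambda1_mul_le G B (f := f + Pi.single w t) (by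
      intro x hx
      have hxw : x ≠ w := by rintro rfl; exact hw hx
      simp [hB x hx, hxw])
    rw [dirichletForm_add_single, sum_compl_sq_add_single B f hw, hf] at h
    rw [hβ]
    linarith
  have := discrim_le_zero key
  simp only [discrim] at this
  have : β = 0 := by nlinarith [sq_nonneg β]
  linarith

/-- The number of boundary vertices adjacent to `w`. -/
noncomputable def boundaryDegree {V : Type*} [Fintype V] (G : SimpleGraph V) (B : Finset V)
    (w : V) : ℕ :=
  (B.filter (G.Adj w)).card

/-- The number of interior vertices adjacent to `w`. -/
noncomputable def interiorDegree {V : Type*} [Fintype V] (G : SimpleGraph V) (B : Finset V)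
    (w : V) : ℕ :=
  (Bᶜ.filter (G.Adj w)).card

theorem degree_eq_boundaryDegree_add_interiorDegree {V : Type*} [Fintype V] (G : SimpleGraph V)
    (B : Finset V) (w : V) : G.degree w = boundaryDegree G B w + interiorDegree G B w := by
  rw [boundaryDegree, interiorDegree, ← SimpleGraph.card_neighborFinset_eq_degree,
    ← Finset.card_union_of_disjoint]
  · congr 1
    ext y
    simp only [SimpleGraph.mem_neighborFinset, Finset.mem_union, Finset.mem_filter,
      Finset.mem_compl]
    tauto
  · exact Finset.disjoint_filter_filter disjoint_compl_right

/-- The function equal to `0` on `B` and to `1` on its complement. -/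
noncomputable def interiorIndicator {V : Type*} (B : Finset V) (y : V) : ℝ :=
  if y ∈ B then 0 else 1

open Matrix in
theorem lapMatrix_mulVec_interiorIndicator {V : Type*} [Fintype V] (G : SimpleGraph V)
    (B : Finset V) {w : V} (hw : w ∉ B) :
    (G.lapMatrix ℝ *ᵥ interiorIndicator B) w = boundaryDegree G B w := by
  have hsum : ∑ u ∈ G.neighborFinset w, interiorIndicator B u = interiorDegree G B w := by
    simp only [interiorIndicator]
    simp_rw [← ite_not (_ ∈ B), Finset.sum_boole]
    rw [interiorDegree]
    congr 2
    ext y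
    simp only [Finset.mem_filter, SimpleGraph.mem_neighborFinset, Finset.mem_compl]
    tauto
  rw [G.lapMatrix_mulVec_apply, hsum, degree_eq_boundaryDegree_add_interiorDegree G B,
    interiorIndicator, if_neg hw]
  push_cast
  ring

theorem dirichletForm_interiorIndicator {V : Type*} [Fintype V] (G : SimpleGraph V)
    (B : Finset V) :
    dirichletForm G (interiorIndicator B) = ∑ w ∈ Bᶜ, (boundaryDegree G B w : ℝ) := by
  rw [dirichletForm_eq_dotProduct, dotProduct, ← Finset.sum_add_sum_compl B,
    Finset.sum_eq_zero, zero_add]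
  · refine Finset.sum_congr rfl fun w hw => ?_
    rw [Finset.mem_compl] at hw
    rw [lapMatrix_mulVec_interiorIndicator G B hw, interiorIndicator, if_neg hw, one_mul]
  · intro w hw
    rw [interiorIndicator, if_pos hw, zero_mul]

theorem sum_boundaryDegree {V : Type*} [Fintype V] (G : SimpleGraph V) (B : Finset V) :
    ∑ w ∈ Bᶜ, boundaryDegree G B w = ∑ l ∈ B, interiorDegree G B l := by
  have h := Finset.sum_card_bipartiteAbove_eq_sum_card_bipartiteBelow (s := Bᶜ) (t := B) G.Adj
  simp only [Finset.bipartiteAbove, Finset.bipartiteBelow] at h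
  simp only [boundaryDegree, interiorDegree, h]
  simp only [G.adj_comm]

/-- The test function equal to `x` at `v`, to `1` at the other interior vertices and to `0`
on the boundary `B`. -/
noncomputable def peakFunction {V : Type*} (B : Finset V) (v : V) (x : ℝ) : V → ℝ :=
  interiorIndicator B + Pi.single v (x - 1)

theorem peakFunction_boundary {V : Type*} (B : Finset V) {v : V} (hv : v ∉ B) (x : ℝ) :
    ∀ y ∈ B, peakFunction B v x y = 0 := by
  intro y hy
  have : y ≠ v := by rintro rfl; exact hv hy
  simp [peakFunction, interiorIndicator, hy, this]

theorem dirichletForm_peakFunction {V : Type*} [Fintype V] (G : SimpleGraph V) (B : Finset V)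
    {v : V} (hv : v ∉ B) (x : ℝ) :
    dirichletForm G (peakFunction B v x) =
      ∑ w ∈ Bᶜ, (boundaryDegree G B w : ℝ) + (x ^ 2 - 1) * boundaryDegree G B v +
        (x - 1) ^ 2 * interiorDegree G B v := by
  rw [peakFunction, dirichletForm_add_single, lapMatrix_mulVec_interiorIndicator G B hv,
    dirichletForm_interiorIndicator, degree_eq_boundaryDegree_add_interiorDegree G B]
  push_cast
  ring

theorem sum_compl_sq_peakFunction {V : Type*} [Fintype V] (B : Finset V)
    {v : V} (hv : v ∉ B) (x : ℝ) :
    ∑ y ∈ Bᶜ, peakFunction B v x y ^ 2 = (Bᶜ.card : ℝ) - 1 + x ^ 2 := by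
  have h : ∑ y ∈ Bᶜ, interiorIndicator B y ^ 2 = Bᶜ.card := by
    rw [Finset.sum_congr rfl (g := fun _ => (1 : ℝ))]
    · simp
    · intro y hy
      simp [interiorIndicator, Finset.mem_compl.mp hy]
  rw [peakFunction, sum_compl_sq_add_single B _ hv, h, interiorIndicator, if_neg hv]
  ring

open Matrix in
theorem lapMatrix_mulVec_peakFunction {V : Type*} [Fintype V] (G : SimpleGraph V) (B : Finset V)
    {v w : V} (hw : w ∉ B) (hadj : G.Adj v w) (x : ℝ) :
    (G.lapMatrix ℝ *ᵥ peakFunction B v x) w = boundaryDegree G B w - (x - 1) := by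
  rw [peakFunction, mulVec_add, Pi.add_apply, lapMatrix_mulVec_interiorIndicator G B hw,
    G.lapMatrix_mulVec_apply, Pi.single_eq_of_ne hadj.ne',
    Finset.sum_pi_single', if_pos ((G.mem_neighborFinset w v).mpr hadj.symm)]
  ring

theorem exists_sigma2_eq (a : ℕ) {k : ℕ} (hk : 2 ≤ k) :
    ∃ x : ℝ, 1 < x ∧ sigma2 a k = a + 2 - x ∧ x ^ 2 + (k - 3) * x = k - 1 := by
  have hk' : (2 : ℝ) ≤ k := by exact_mod_cast hk
  refine ⟨(3 - k + √((k - 1 : ℝ) ^ 2 + 4)) / 2, ?_, ?_, ?_⟩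
  · have : (k - 1 : ℝ) < √((k - 1 : ℝ) ^ 2 + 4) :=
      Real.lt_sqrt_of_sq_lt (by linarith)
    linarith
  · rw [sigma2]
    ring
  · have := Real.sq_sqrt (show (0 : ℝ) ≤ (k - 1 : ℝ) ^ 2 + 4 by positivity)
    nlinarith

theorem interiorDegree_le_one_of_mem_leaves {V : Type*} [Fintype V] (T : SimpleGraph V) {l : V}
    (hl : l ∈ leaves T) : interiorDegree T (leaves T) l ≤ 1 := by
  have h := degree_eq_boundaryDegree_add_interiorDegree T (leaves T) l
  have h1 : T.degree l = 1 := by simpa [leaves] using hl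
  omega

theorem interiorDegree_lt {V : Type*} [Fintype V] (G : SimpleGraph V) (B : Finset V) {v : V}
    (hv : v ∉ B) : interiorDegree G B v < Bᶜ.card := by
  refine Finset.card_lt_card (Finset.filter_ssubset.mpr ⟨v, by simpa using hv, ?_⟩)
  exact G.loopless.irrefl v

theorem adj_of_interiorDegree_eq {V : Type*} [Fintype V] (G : SimpleGraph V) (B : Finset V)
    {v : V} (hv : v ∉ B) (h : interiorDegree G B v + 1 = Bᶜ.card) {w : V} (hw : w ∉ B)
    (hwv : w ≠ v) : G.Adj v w := by
  have hsub : Bᶜ.filter (G.Adj v) ⊆ Bᶜ.erase v := by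
    intro y hy
    rw [Finset.mem_filter] at hy
    exact Finset.mem_erase.mpr ⟨hy.2.ne', hy.1⟩
  have heq := Finset.eq_of_subset_of_card_le hsub (by
    rw [Finset.card_erase_of_mem (Finset.mem_compl.mpr hv)]
    unfold interiorDegree at h
    omega)
  have : w ∈ Bᶜ.filter (G.Adj v) := by
    rw [heq]
    exact Finset.mem_erase.mpr ⟨hwv, Finset.mem_compl.mpr hw⟩
  exact (Finset.mem_filter.mp this).2

theorem exists_boundaryDegree_le {V : Type*} [Fintype V] (a k : ℕ) (hk : 2 ≤ k)
    (T : SimpleGraph V) (hint : ((leaves T)ᶜ : Finset V).card = k)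
    (hleaf : (leaves T).card = a * k + k - 1) :
    ∑ w ∈ (leaves T)ᶜ, boundaryDegree T (leaves T) w ≤ a * k + k - 1 ∧
      ∃ v ∉ leaves T, boundaryDegree T (leaves T) v ≤ a := by
  have hsum : ∑ w ∈ (leaves T)ᶜ, boundaryDegree T (leaves T) w ≤ a * k + k - 1 := by
    rw [sum_boundaryDegree, ← hleaf, Finset.card_eq_sum_ones]
    exact Finset.sum_le_sum fun l hl => interiorDegree_le_one_of_mem_leaves T hl
  refine ⟨hsum, ?_⟩
  by_contra! h
  have hlower : k * (a + 1) ≤ ∑ w ∈ (leaves T)ᶜ, boundaryDegree T (leaves T) w := by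
    simpa only [hint, smul_eq_mul] using
      Finset.card_nsmul_le_sum (leaves T)ᶜ (boundaryDegree T (leaves T)) (a + 1)
        fun v hv => h v (Finset.mem_compl.mp hv)
  have hmul : k * (a + 1) = a * k + k := by ring
  omega

/-- The Rayleigh quotient of `peakFunction` at a vertex with few adjacent leaves
is at most `sigma2 a k`, and equality forces the shape of the tree near that vertex. -/
theorem dirichletForm_peakFunction_le {V : Type*} [Fintype V] (a k : ℕ) (hk : 2 ≤ k)
    (T : SimpleGraph V) (hint : ((leaves T)ᶜ : Finset V).card = k)
    (hsum : ∑ w ∈ (leaves T)ᶜ, boundaryDegree T (leaves T) w ≤ a * k + k - 1)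
    {v : V} (hv : v ∉ leaves T) (hva : boundaryDegree T (leaves T) v ≤ a)
    {x : ℝ} (hx1 : 1 < x) (hσ : sigma2 a k = a + 2 - x)
    (hx : x ^ 2 + (k - 3) * x = k - 1) :
    dirichletForm T (peakFunction (leaves T) v x) ≤
        sigma2 a k * ∑ y ∈ (leaves T)ᶜ, peakFunction (leaves T) v x y ^ 2 ∧
      (dirichletForm T (peakFunction (leaves T) v x) =
        sigma2 a k * ∑ y ∈ (leaves T)ᶜ, peakFunction (leaves T) v x y ^ 2 →
      ∑ w ∈ (leaves T)ᶜ, boundaryDegree T (leaves T) w = a * k + k - 1 ∧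
        boundaryDegree T (leaves T) v = a ∧ interiorDegree T (leaves T) v + 1 = k) := by
  have hd := interiorDegree_lt T (leaves T) hv
  rw [hint] at hd
  rw [dirichletForm_peakFunction T _ hv, sum_compl_sq_peakFunction _ hv, hint, hσ]
  set S := ∑ w ∈ (leaves T)ᶜ, boundaryDegree T (leaves T) w
  have hcast : ∑ w ∈ (leaves T)ᶜ, (boundaryDegree T (leaves T) w : ℝ) = (S : ℝ) := by
    push_cast [S]
    rfl
  rw [hcast]
  set b := boundaryDegree T (leaves T) v
  set d := interiorDegree T (leaves T) v
  have hS' : (S : ℝ) + 1 ≤ a * k + k := by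
    have : S + 1 ≤ a * k + k := by omega
    exact_mod_cast this
  have hb' : (b : ℝ) ≤ a := by exact_mod_cast hva
  have hd' : (d : ℝ) + 1 ≤ k := by exact_mod_cast hd
  have hid : (a + 2 - x) * ((k : ℝ) - 1 + x ^ 2) =
      a * k + k - 1 + (x ^ 2 - 1) * a + (x - 1) ^ 2 * (k - 1) := by
    linear_combination (-x) * hx
  have hx2 : 0 < x ^ 2 - 1 := by nlinarith
  have hx3 : 0 < (x - 1) ^ 2 := by
    have : 0 < x - 1 := by linarith
    positivity
  have h1 : (x ^ 2 - 1) * b ≤ (x ^ 2 - 1) * a := by gcongr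
  have h2 : (x - 1) ^ 2 * d ≤ (x - 1) ^ 2 * ((k : ℝ) - 1) := by
    gcongr
    linarith
  rw [hid]
  refine ⟨by linarith, fun h => ⟨?_, ?_, ?_⟩⟩
  · have : (S : ℝ) + 1 = a * k + k := by linarith
    have : S + 1 = a * k + k := by exact_mod_cast this
    omega
  · have : (b : ℝ) = a := mul_left_cancel₀ hx2.ne' (by linarith)
    exact_mod_cast this
  · have : (d : ℝ) = k - 1 := mul_left_cancel₀ hx3.ne' (by linarith)
    have : (d : ℝ) + 1 = k := by linarith
    exact_mod_cast this

theorem mem_leaves_iff {V : Type*} [Fintype V] (G : SimpleGraph V) (v : V) :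
    v ∈ leaves G ↔ ∃! w, G.Adj v w := by
  simp [leaves, SimpleGraph.degree_eq_one_iff_existsUnique_adj]

theorem sum_SLPVert {p q d : ℕ} (F : SLPVert p q 0 d 0 → ℝ) :
    ∑ x, F x = F (.path 0) + ∑ i, F (.dbr i) + ∑ j, F (.pleaf0 j) +
      ∑ i, ∑ j, F (.qleafD i j) := by
  let e : (Unit ⊕ Fin d) ⊕ (Fin p ⊕ Fin d × Fin q) ≃ SLPVert p q 0 d 0 :=
    { toFun := Sum.elim (Sum.elim (fun _ => .path 0) .dbr)
        (Sum.elim .pleaf0 fun ij => .qleafD ij.1 ij.2)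
      invFun := fun x => match x with
        | .path _ => .inl (.inl ())
        | .dbr i => .inl (.inr i)
        | .pleaf0 j => .inr (.inl j)
        | .qleafD i j => .inr (.inr (i, j))
        | .ebr j => j.elim0
        | .pleafc j => Fin.elim0 (α := _) j
        | .qleafE j _ => j.elim0
        | .qleafM m _ => m.elim0
      left_inv := by rintro ((_ | i) | (j | ⟨i, j⟩)) <;> rfl
      right_inv := by
        rintro (i | i | j | j | j | ⟨i, j⟩ | ⟨j, _⟩ | ⟨m, _⟩)
        · exact congrArg SLPVert.path (Subsingleton.elim (α := Fin 1) 0 i)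
        all_goals first | rfl | exact Fin.elim0 ‹_› }
  rw [← e.sum_comp]
  simp [e, Fintype.sum_sum_type, Fintype.sum_prod_type, add_assoc]

theorem pleaf0_mem_leaves {p q d : ℕ} (j : Fin p) :
    (.pleaf0 j : SLPVert p q 0 d 0) ∈ leaves (SLP p q 0 d 0) := by
  rw [mem_leaves_iff]
  refine ⟨.path 0, by simp [SLP, SLPRel], ?_⟩
  rintro (i | i | j | j | j | ⟨i, j⟩ | ⟨j, _⟩ | ⟨m, _⟩) <;> simp [SLP, SLPRel]
  exact Subsingleton.elim _ _

theorem qleafD_mem_leaves {p q d : ℕ} (i : Fin d) (j : Fin q) :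
    (.qleafD i j : SLPVert p q 0 d 0) ∈ leaves (SLP p q 0 d 0) := by
  rw [mem_leaves_iff]
  refine ⟨.dbr i, by simp [SLP, SLPRel], ?_⟩
  rintro (i | i | j | j | j | ⟨i, j⟩ | ⟨j, _⟩ | ⟨m, _⟩) <;> simp [SLP, SLPRel]

theorem dirichletForm_SLP {p q d : ℕ} (g : SLPVert p q 0 d 0 → ℝ)
    (hg : ∀ x ∈ leaves (SLP p q 0 d 0), g x = 0) :
    dirichletForm (SLP p q 0 d 0) g =
      ∑ i, ((g (.path 0) - g (.dbr i)) ^ 2 + q * g (.dbr i) ^ 2) + p * g (.path 0) ^ 2 := by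
  have h0 : ∀ j, g (.pleaf0 j) = 0 := fun j => hg _ (pleaf0_mem_leaves j)
  have hD : ∀ i j, g (.qleafD i j) = 0 := fun i j => hg _ (qleafD_mem_leaves i j)
  rw [dirichletForm]
  simp only [sum_SLPVert, h0, hD]
  simp [SLP, SLPRel, Finset.sum_add_distrib, Finset.sum_ite_eq]
  simp only [sub_sq_comm (g (.path 0)), ← Finset.mul_sum]
  ring

theorem sigma2_mul_le_dirichletForm_SLP (a : ℕ) {k : ℕ} (hk : 2 ≤ k)
    (g : SLPVert a (a + 1) 0 (k - 1) 0 → ℝ)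
    (hg : ∀ x ∈ leaves (SLP a (a + 1) 0 (k - 1) 0), g x = 0) :
    sigma2 a k * ∑ x, g x ^ 2 ≤ dirichletForm (SLP a (a + 1) 0 (k - 1) 0) g := by
  have h0 : ∀ j, g (.pleaf0 j) = 0 := fun j => hg _ (pleaf0_mem_leaves j)
  have hD : ∀ i j, g (.qleafD i j) = 0 := fun i j => hg _ (qleafD_mem_leaves i j)
  obtain ⟨x, hx1, hσ, hx⟩ := exists_sigma2_eq a hk
  have hx0 : 0 < x := by linarith
  rw [dirichletForm_SLP g hg, sum_SLPVert, hσ]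
  simp only [h0, hD]
  have hsq : ∀ i, 0 ≤ (x * g (.dbr i) - g (.path 0)) ^ 2 / x := fun i => by positivity
  have hcard : ∑ _i : Fin (k - 1), g (.path 0) ^ 2 = ((k : ℝ) - 1) * g (.path 0) ^ 2 := by
    simp [Nat.cast_sub (show 1 ≤ k by omega)]
  have hkey : (∑ i, ((g (.path 0) - g (.dbr i)) ^ 2 + ((a + 1 : ℕ) : ℝ) * g (.dbr i) ^ 2) +
        a * g (.path 0) ^ 2) -
      (a + 2 - x) * (g (.path 0) ^ 2 + ∑ i, g (.dbr i) ^ 2) =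
      ∑ i, (x * g (.dbr i) - g (.path 0)) ^ 2 / x := by
    have hterm : ∀ i : Fin (k - 1), (x * g (.dbr i) - g (.path 0)) ^ 2 / x =
        ((g (.path 0) - g (.dbr i)) ^ 2 + ((a + 1 : ℕ) : ℝ) * g (.dbr i) ^ 2) -
          (a + 2 - x) * g (.dbr i) ^ 2 + (1 / x - 1) * g (.path 0) ^ 2 := by
      intro i
      push_cast
      field_simp
      ring
    simp only [hterm]
    rw [Finset.sum_add_distrib (f := fun i => _ - _), Finset.sum_sub_distrib, ← Finset.mul_sum,
      ← Finset.mul_sum, hcard]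
    have : (1 / x - 1) * ((k : ℝ) - 1) = x - 2 := by
      field_simp
      linarith
    linear_combination (-g (.path 0) ^ 2) * this
  have := Finset.sum_nonneg fun i (_ : i ∈ Finset.univ) => hsq i
  simp only [ne_eq, OfNat.ofNat_ne_zero, not_false_eq_true, zero_pow, Finset.sum_const_zero,
    add_zero]
  linarith

theorem Iso.mem_leaves_iff {V W : Type*} [Fintype V] [Fintype W] {G : SimpleGraph V}
    {H : SimpleGraph W} (e : G ≃g H) (v : V) : e v ∈ leaves H ↔ v ∈ leaves G := by
  rw [_root_.mem_leaves_iff, _root_.mem_leaves_iff, ← e.toEquiv.existsUnique_congr_right]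
  exact existsUnique_congr fun w => e.map_adj_iff

theorem Iso.dirichletForm_comp {V W : Type*} [Fintype V] [Fintype W] {G : SimpleGraph V}
    {H : SimpleGraph W} (e : G ≃g H) (f : W → ℝ) :
    dirichletForm G (f ∘ e) = dirichletForm H f := by
  simp only [dirichletForm]
  rw [← e.toEquiv.sum_comp]
  congr 1
  refine Finset.sum_congr rfl fun x _ => ?_
  rw [← e.toEquiv.sum_comp]
  refine Finset.sum_congr rfl fun y _ => ?_
  simp [e.map_adj_iff]

theorem sigma2_le_lambda1_of_iso {V : Type*} [Fintype V] (a k : ℕ) (hk : 2 ≤ k)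
    (T : SimpleGraph V) (hint : ((leaves T)ᶜ : Finset V).card = k)
    (e : T ≃g SLP a (a + 1) 0 (k - 1) 0) : sigma2 a k ≤ lambda1 T (leaves T) := by
  refine le_lambda1 T (Finset.card_pos.mp (by omega)) fun f hf => ?_
  have h := sigma2_mul_le_dirichletForm_SLP a hk (f ∘ e.symm) fun x hx =>
    hf _ ((Iso.mem_leaves_iff e.symm x).mpr hx)
  rw [Iso.dirichletForm_comp] at h
  have hsum : ∑ x, (f ∘ e.symm) x ^ 2 = ∑ x ∈ (leaves T)ᶜ, f x ^ 2 := by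
    rw [← e.toEquiv.sum_comp, Finset.sum_subset (Finset.subset_univ (leaves T)ᶜ)]
    · simp
    · intro x _ hx
      rw [hf x (by simpa using hx)]
      simp
  rwa [hsum] at h

theorem Finset.exists_injective_enumeration {V : Type*} {n : ℕ} {s : Finset V}
    (h : s.card = n) : ∃ f : Fin n → V, Function.Injective f ∧ ∀ y, y ∈ s ↔ ∃ i, f i = y := by
  let e := (Finset.equivFinOfCardEq h).symm
  refine ⟨fun i => e i, Subtype.val_injective.comp e.injective, fun y => ⟨fun hy => ?_, ?_⟩⟩
  · exact ⟨e.symm ⟨y, hy⟩, by simp⟩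
  · rintro ⟨i, rfl⟩
    exact (e i).2

/-- A graph whose interior vertices form a star, with prescribed numbers of leaves
at the centre and at the other interior vertices, is a star-like path tree. -/
theorem nonempty_iso_SLP {V : Type*} [Fintype V] {p q d : ℕ} (T : SimpleGraph V) {v : V}
    (hv : v ∉ leaves T) (hcard : (leaves T)ᶜ.card = d + 1)
    (hstar : ∀ w ∉ leaves T, w ≠ v → T.Adj v w)
    (hindep : ∀ w ∉ leaves T, ∀ w' ∉ leaves T, w ≠ v → w' ≠ v → ¬ T.Adj w w')
    (hleaf : ∀ l ∈ leaves T, ∃ w ∉ leaves T, T.Adj l w)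
    (hp : boundaryDegree T (leaves T) v = p)
    (hq : ∀ w ∉ leaves T, w ≠ v → boundaryDegree T (leaves T) w = q) :
    Nonempty (T ≃g SLP p q 0 d 0) := by
  have huniq : ∀ l ∈ leaves T, ∀ x y, T.Adj x l → T.Adj y l → x = y := fun l hl x y hx hy =>
    ((mem_leaves_iff T l).mp hl).unique hx.symm hy.symm
  have hll : ∀ l ∈ leaves T, ∀ l' ∈ leaves T, ¬ T.Adj l l' := by
    intro l hl l' hl' h
    obtain ⟨w, hw, hlw⟩ := hleaf l hl
    exact hw (huniq l hl w l' hlw.symm h.symm ▸ hl')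
  have hcard' : ((leaves T)ᶜ.erase v).card = d := by
    rw [Finset.card_erase_of_mem (Finset.mem_compl.mpr hv), hcard, Nat.add_sub_cancel]
  obtain ⟨W, hWinj, hWmem⟩ := Finset.exists_injective_enumeration hcard'
  simp only [Finset.mem_erase, Finset.mem_compl] at hWmem
  have hW : ∀ i, W i ≠ v ∧ W i ∉ leaves T := fun i => (hWmem _).mpr ⟨i, rfl⟩
  obtain ⟨P, hPinj, hPmem⟩ := Finset.exists_injective_enumeration hp
  simp only [Finset.mem_filter] at hPmem
  have hP : ∀ j, P j ∈ leaves T ∧ T.Adj v (P j) := fun j => (hPmem _).mpr ⟨j, rfl⟩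
  choose Q hQinj hQmem using fun i =>
    Finset.exists_injective_enumeration (hq _ (hW i).2 (hW i).1)
  simp only [Finset.mem_filter] at hQmem
  have hQ : ∀ i j, Q i j ∈ leaves T ∧ T.Adj (W i) (Q i j) := fun i j =>
    (hQmem i _).mpr ⟨j, rfl⟩
  have hvW : ∀ i, T.Adj v (W i) := fun i => hstar _ (hW i).2 (hW i).1
  have hWW : ∀ i i', ¬ T.Adj (W i) (W i') := fun i i' =>
    hindep _ (hW i).2 _ (hW i').2 (hW i).1 (hW i').1
  have hvQ : ∀ i j, ¬ T.Adj v (Q i j) := fun i j h =>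
    (hW i).1 (huniq _ (hQ i j).1 _ _ (hQ i j).2 h)
  have hWP : ∀ i j, ¬ T.Adj (W i) (P j) := fun i j h =>
    (hW i).1 (huniq _ (hP j).1 _ _ h (hP j).2)
  have hWQ : ∀ i i' j, T.Adj (W i) (Q i' j) ↔ i = i' := fun i i' j =>
    ⟨fun h => hWinj (huniq _ (hQ i' j).1 _ _ h (hQ i' j).2), fun h => h ▸ (hQ i j).2⟩
  have hPQ : ∀ j i' j', P j ≠ Q i' j' := fun j i' j' h => hvQ i' j' (h ▸ (hP j).2)
  have hQne : ∀ i j i' j', Q i j = Q i' j' → i = i' ∧ j = j' := by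
    intro i j i' j' h
    obtain rfl : i = i' := (hWQ i i' j').mp (h ▸ (hQ i j).2)
    exact ⟨rfl, hQinj i h⟩
  let φ : SLPVert p q 0 d 0 → V := fun x => match x with
    | .path _ => v
    | .dbr i => W i
    | .pleaf0 j => P j
    | .qleafD i j => Q i j
    | .ebr j => j.elim0
    | .pleafc j => Fin.elim0 (α := _) j
    | .qleafE j _ => j.elim0
    | .qleafM m _ => m.elim0
  have hφsurj : Function.Surjective φ := by
    intro y
    by_cases hy : y ∈ leaves T
    · obtain ⟨w, hw, hyw⟩ := hleaf y hy
      by_cases hwv : w = v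
      · obtain ⟨j, hj⟩ := (hPmem y).mp ⟨hy, hwv ▸ hyw.symm⟩
        exact ⟨.pleaf0 j, hj⟩
      · obtain ⟨i, rfl⟩ := (hWmem w).mp ⟨hwv, hw⟩
        obtain ⟨j, hj⟩ := (hQmem i y).mp ⟨hy, hyw.symm⟩
        exact ⟨.qleafD i j, hj⟩
    · by_cases hyv : y = v
      · exact ⟨.path 0, hyv.symm⟩
      · obtain ⟨i, hi⟩ := (hWmem y).mp ⟨hyv, hy⟩
        exact ⟨.dbr i, hi⟩
  have hφinj : Function.Injective φ := by
    rintro (i | i | j | j | j | ⟨i, j⟩ | ⟨j, _⟩ | ⟨m, _⟩)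
      (i' | i' | j' | j' | j' | ⟨i', j'⟩ | ⟨j', _⟩ | ⟨m', _⟩) h
    all_goals first
      | exact Fin.elim0 ‹Fin 0›
      | skip
    all_goals simp only [φ] at h
    · exact congrArg SLPVert.path (Subsingleton.elim (α := Fin 1) i i')
    all_goals grind only
  have hφadj : ∀ x y, T.Adj (φ x) (φ y) ↔ (SLP p q 0 d 0).Adj x y := by
    rintro (i | i | j | j | j | ⟨i, j⟩ | ⟨j, _⟩ | ⟨m, _⟩)
      (i' | i' | j' | j' | j' | ⟨i', j'⟩ | ⟨j', _⟩ | ⟨m', _⟩)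
    all_goals first
      | exact Fin.elim0 ‹Fin 0›
      | skip
    all_goals simp [SLP, SLPRel, φ, hvW, hWW, hvQ, hWP, hWQ, hP, hQ, hll, T.adj_comm _ v,
      T.adj_comm (P _) (W _), T.adj_comm (Q _ _) (W _), eq_comm]
  exact ⟨(⟨Equiv.ofBijective φ ⟨hφinj, hφsurj⟩, hφadj _ _⟩ : SLP p q 0 d 0 ≃g T).symm⟩

/-- If equality holds for `T`, then `T` is the star-like path tree. -/
theorem nonempty_iso_of_lambda1_eq {V : Type*} [Fintype V] (a k : ℕ) (hk : 2 ≤ k)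
    (T : SimpleGraph V) (hT : T.IsAcyclic)
    (hint : ((leaves T)ᶜ : Finset V).card = k)
    (hleaf : (leaves T).card = a * k + k - 1)
    (hsum : ∑ w ∈ (leaves T)ᶜ, boundaryDegree T (leaves T) w ≤ a * k + k - 1)
    {v : V} (hv : v ∉ leaves T) (hva : boundaryDegree T (leaves T) v ≤ a)
    {x : ℝ} (hx1 : 1 < x) (hσ : sigma2 a k = a + 2 - x)
    (hx : x ^ 2 + (k - 3) * x = k - 1) (heq : lambda1 T (leaves T) = sigma2 a k) :
    Nonempty (T ≃g SLP a (a + 1) 0 (k - 1) 0) := by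
  obtain ⟨hle, hshape⟩ := dirichletForm_peakFunction_le a k hk T hint hsum hv hva hx1 hσ hx
  rw [← heq] at hle hshape
  have hmin := hle.antisymm (lambda1_mul_le T (leaves T) (peakFunction_boundary _ hv x))
  obtain ⟨hS, hb, hd⟩ := hshape hmin
  have hstar : ∀ w ∉ leaves T, w ≠ v → T.Adj v w := fun w hw hwv =>
    adj_of_interiorDegree_eq T _ hv (hd.trans hint.symm) hw hwv
  refine nonempty_iso_SLP T hv (by omega) hstar ?_ ?_ hb ?_
  · intro w hw w' hw' hwv hwv' hadj
    exact hT.cliqueFree le_rfl {v, w, w'} (SimpleGraph.is3Clique_triple_iff.mpr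
      ⟨hstar w hw hwv, hstar w' hw' hwv', hadj⟩)
  · have hone : ∀ l ∈ leaves T, interiorDegree T (leaves T) l = 1 := by
      refine (Finset.sum_eq_sum_iff_of_le fun l hl =>
        interiorDegree_le_one_of_mem_leaves T hl).mp ?_
      rw [← sum_boundaryDegree, hS, ← hleaf, Finset.card_eq_sum_ones]
    intro l hl
    obtain ⟨w, hw⟩ := Finset.card_pos.mp (show 0 < interiorDegree T (leaves T) l by
      rw [hone l hl]; exact one_pos)
    rw [Finset.mem_filter, Finset.mem_compl] at hw
    exact ⟨w, hw⟩
  · intro w hw hwv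
    have h := lapMatrix_mulVec_eq_of_minimizer T _ (peakFunction_boundary _ hv x) hmin hw
    rw [lapMatrix_mulVec_peakFunction T _ hw (hstar w hw hwv), heq, hσ] at h
    simp only [peakFunction, interiorIndicator, Pi.add_apply, if_neg hw,
      Pi.single_eq_of_ne hwv] at h
    have : (boundaryDegree T (leaves T) w : ℝ) = a + 1 := by linarith
    exact_mod_cast this

theorem stmt17 {V : Type*} [Fintype V] (a k : ℕ) (hk : 2 ≤ k)
    (T : SimpleGraph V) (hT : T.IsTree)
    (hint : ((leaves T)ᶜ : Finset V).card = k)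
    (hleaf : (leaves T).card = a * k + k - 1) :
    lambda1 T (leaves T) ≤ sigma2 a k ∧
    (lambda1 T (leaves T) = sigma2 a k ↔
      Nonempty (T ≃g SLP a (a + 1) 0 (k - 1) 0)) := by
  obtain ⟨hsum, v, hv, hva⟩ := exists_boundaryDegree_le a k hk T hint hleaf
  obtain ⟨x, hx1, hσ, hx⟩ := exists_sigma2_eq a hk
  have hle : lambda1 T (leaves T) ≤ sigma2 a k := by
    have h := (lambda1_mul_le T (leaves T) (peakFunction_boundary _ hv x)).trans
      (dirichletForm_peakFunction_le a k hk T hint hsum hv hva hx1 hσ hx).1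
    refine le_of_mul_le_mul_right h ?_
    rw [sum_compl_sq_peakFunction _ hv, hint]
    have : (2 : ℝ) ≤ k := by exact_mod_cast hk
    nlinarith [sq_nonneg x]
  refine ⟨hle, fun heq => ?_, fun ⟨e⟩ => ?_⟩
  · exact nonempty_iso_of_lambda1_eq a k hk T hT.isAcyclic hint hleaf hsum hv hva hx1 hσ hx heq
  · exact hle.antisymm (sigma2_le_lambda1_of_iso a k hk T hint e)
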